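/- Let $s_0, \dots, s_J \in \mathbb{C}$ be distinct support points and $w_0, \dots, w_J \in \mathbb{C}$ be weights, and define $D(z) = \sum_{j=0}^{J} w_j/(z - s_j)$. Let $E$ be the $(J+2)\times(J+2)$ complex matrix whose $(0,0)$ entry is $0$, whose remaining first-row entries are $E_{0,j+1} = w_j$, whose remaining first-column entries are $E_{j+1,0} = 1$, whose diagonal entries are $E_{j+1,j+1} = s_j$, and all other entries zero; and let $B$ be the diagonal matrix with $B_{0,0} = 0$ and $B_{j+1,j+1} = 1$ for $j = 0,\dots,J$. Then for every $\lambda \notin \{s_0,\dots,s_J\}$, $\det(\lambda B - E) = -\Big(\prod_{j=0}^{J}(\lambda - s_j)\Big) D(\lambda)$. Consequently, $\lambda \notin \{s_0,\dots,s_J\}$ satisfies $D(\lambda) = 0$ (i.e., $\lambda$ is a pole of the barycentric rational function) if and only if $\lambda$ is a generalized eigenvalue of the pencil $(E, B)$, i.e., $\det(\lambda B - E) = 0$. -/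

import Mathlib

open Finset Matrix

/-- Determinant of an arrowhead matrix with corner `a`, border row `u`, border column `v` and
nonvanishing diagonal `d`. -/
theorem det_arrowhead {K : Type*} [Field K] {n : ℕ} (a : K) (u v d : Fin n → K)
    (hd : ∀ j, d j ≠ 0) (M : Matrix (Fin (n + 1)) (Fin (n + 1)) K)
    (h00 : M 0 0 = a) (h0s : ∀ j, M 0 j.succ = u j) (hs0 : ∀ i, M i.succ 0 = v i)
    (hss : ∀ i j, M i.succ j.succ = diagonal d i j) :
    M.det = (∏ j, d j) * (a - ∑ j, u j * v j / d j) := by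
  let P : Matrix (Fin (n + 1)) (Fin (n + 1)) K :=
    of (Fin.cons (Fin.cons 1 0) fun i => Fin.cons (-(v i / d i)) ((1 : Matrix (Fin n) (Fin n) K) i))
  have hP : P.det = 1 := by
    rw [det_succ_row_zero, Fin.sum_univ_succ]
    have hsub : P.submatrix Fin.succ Fin.succ = 1 := by
      ext i j
      simp [P]
    simp [hsub, P]
  have hcol : ∀ i : Fin n, (M * P) i.succ 0 = 0 := by
    intro i
    simp [mul_apply, Fin.sum_univ_succ, P, hs0, hss, diagonal_apply, mul_div_cancel₀ _ (hd i)]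
  have hcorner : (M * P) 0 0 = a - ∑ j, u j * v j / d j := by
    simp [mul_apply, Fin.sum_univ_succ, P, h00, h0s, sub_eq_add_neg, mul_div_assoc]
  have hsub : (M * P).submatrix Fin.succ Fin.succ = diagonal d := by
    ext i j
    simp [mul_apply, Fin.sum_univ_succ, P, hss, one_apply]
  have hMP : (M * P).det = (∏ j, d j) * (a - ∑ j, u j * v j / d j) := by
    rw [det_succ_column_zero, Fin.sum_univ_succ]
    simp [hcol, hcorner, hsub, mul_comm]
  rwa [det_mul, hP, mul_one] at hMP

/-- The poles of the barycentric rational function (zeros of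
`D(λ) = ∑ w j / (λ - s j)` outside the support set) are exactly the generalized
eigenvalues of the pencil `(E, B)`, where `E` has first row `(0, w₀, …, w_J)`,
first column `(0, 1, …, 1)ᵀ`, and diagonal `(0, s₀, …, s_J)`, and `B` is the
diagonal matrix `diag(0, 1, …, 1)`:
`det(λB - E) = -(∏ j (λ - s j)) · D(λ)` for `λ` outside the support set. -/
theorem barycentric_poles_generalized_eigenvalues (J : ℕ)
    (s w : Fin (J + 1) → ℂ)
    (E B : Matrix (Fin (J + 2)) (Fin (J + 2)) ℂ)
    (hE : E = Matrix.of fun i k =>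
      Fin.cases (motive := fun _ => ℂ)
        (Fin.cases (motive := fun _ => ℂ) 0 (fun j => w j) k)
        (fun j' => Fin.cases (motive := fun _ => ℂ) 1
          (fun j => if j' = j then s j else 0) k) i)
    (hB : B = Matrix.diagonal
      (Fin.cases (motive := fun _ => ℂ) 0 (fun _ => 1))) :
    ∀ lam : ℂ, (∀ j, lam ≠ s j) →
      (lam • B - E).det
          = -(∏ j, (lam - s j)) * (∑ j, w j / (lam - s j)) ∧
      ((∑ j, w j / (lam - s j)) = 0 ↔ (lam • B - E).det = 0) := by
  intro lam hlam
  have hd : ∀ j, lam - s j ≠ 0 := fun j => sub_ne_zero.mpr (hlam j)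
  have hdet : (lam • B - E).det = -(∏ j, (lam - s j)) * (∑ j, w j / (lam - s j)) := by
    rw [det_arrowhead 0 (fun j => -w j) (fun _ => -1) (fun j => lam - s j) hd]
    · simp
    · simp [hE, hB]
    · intro j
      simp [hE, hB, (Fin.succ_ne_zero j).symm]
    · intro i
      simp [hE, hB]
    · intro i j
      by_cases hij : i = j <;> simp [hE, hB, hij]
  refine ⟨hdet, ?_⟩
  rw [hdet, mul_eq_zero, neg_eq_zero, or_iff_right (prod_ne_zero_iff.mpr fun j _ => hd j)]
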